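/- Let a < b be real numbers such that Δ(a)² = Δ(b)² = 1 and Δ(z)² > 1 for all z ∈ (a,b) (i.e. [a,b] is the closure of a nondegenerate spectral gap). Then the function z ↦ ỹ₁₂(L,z) has exactly one zero in the interval [a,b]. -/

import Mathlib

noncomputable section

/-- The third Pauli matrix. -/
def sigma3 : Matrix (Fin 2) (Fin 2) ℂ := !![1, 0; 0, -1]

/-- The matrix potential `Q(x)`. -/
def Qmat (q : ℝ → ℂ) (x : ℝ) : Matrix (Fin 2) (Fin 2) ℂ :=
  !![0, q x; (starRingEnd ℂ) (q x), 0]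

/-- The similarity transformation matrix `U`. -/
def Umat : Matrix (Fin 2) (Fin 2) ℂ := !![1, 1; -Complex.I, Complex.I]

/-- `Ỹ(x,z) = U Y(x,z) U⁻¹`. -/
def Ytil (Y : ℂ → ℝ → Matrix (Fin 2) (Fin 2) ℂ) (z : ℂ) (x : ℝ) :
    Matrix (Fin 2) (Fin 2) ℂ :=
  Umat * Y z x * Umat⁻¹

/-- `(u, v)` solves the real Dirac system `u' = p u + (z + r) v`, `v' = (r - z) u - p v`. -/
def IsDiracSolution (p r : ℝ → ℝ) (z : ℝ) (u v : ℝ → ℝ) : Prop :=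
  ∀ x, HasDerivAt u (p x * u x + (z + r x) * v x) x ∧
    HasDerivAt v ((r x - z) * u x - p x * v x) x

namespace IsDiracSolution

variable {p r : ℝ → ℝ}

lemma continuous_fst {z : ℝ} {u v : ℝ → ℝ} (h : IsDiracSolution p r z u v) : Continuous u :=
  continuous_iff_continuousAt.2 fun x => (h x).1.continuousAt

lemma continuous_snd {z : ℝ} {u v : ℝ → ℝ} (h : IsDiracSolution p r z u v) : Continuous v :=
  continuous_iff_continuousAt.2 fun x => (h x).2.continuousAt

lemma hasDerivAt_wronskian {z w : ℝ} {u v b d : ℝ → ℝ} (h : IsDiracSolution p r z u v)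
    (k : IsDiracSolution p r w b d) (x : ℝ) :
    HasDerivAt (fun t => d t * u t - b t * v t) ((z - w) * (b x * u x + d x * v x)) x := by
  refine (((k x).2.mul (h x).1).sub ((k x).1.mul (h x).2)).congr_deriv ?_
  ring

lemma wronskian_eq {z w : ℝ} {u v b d : ℝ → ℝ} (h : IsDiracSolution p r z u v)
    (k : IsDiracSolution p r w b d) (x : ℝ) :
    d x * u x - b x * v x =
      d 0 * u 0 - b 0 * v 0 + (z - w) * ∫ t in (0 : ℝ)..x, (b t * u t + d t * v t) := by
  have hc : Continuous fun t => b t * u t + d t * v t :=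
    (k.continuous_fst.mul h.continuous_fst).add (k.continuous_snd.mul h.continuous_snd)
  have := intervalIntegral.integral_eq_sub_of_hasDerivAt
    (fun t (_ : t ∈ Set.uIcc 0 x) => h.hasDerivAt_wronskian k t)
    ((continuous_const.mul hc).intervalIntegrable 0 x)
  rw [intervalIntegral.integral_const_mul] at this
  linarith

lemma wronskian_const {z : ℝ} {u v b d : ℝ → ℝ} (h : IsDiracSolution p r z u v)
    (k : IsDiracSolution p r z b d) (x : ℝ) :
    d x * u x - b x * v x = d 0 * u 0 - b 0 * v 0 := by
  simpa using h.wronskian_eq k x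

/-- Solutions on `[0, L]` are bounded uniformly in the real spectral parameter. -/
lemma exists_bound (hp : Continuous p) (hr : Continuous r) (L : ℝ) :
    ∃ C : ℝ, ∀ z u v, IsDiracSolution p r z u v → ∀ x ∈ Set.Icc 0 L,
      u x ^ 2 + v x ^ 2 ≤ C * (u 0 ^ 2 + v 0 ^ 2) := by
  obtain ⟨K, hK⟩ := (isCompact_Icc (a := (0 : ℝ)) (b := L)).exists_bound_of_continuousOn
    ((hp.abs.add hr.abs).continuousOn)
  refine ⟨Real.exp (2 * |K| * L), fun z u v h x hx => ?_⟩
  have hd : ∀ t, HasDerivAt (fun t => Real.exp (-(2 * |K|) * t) * (u t ^ 2 + v t ^ 2))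
      (Real.exp (-(2 * |K|) * t) * (2 * (p t * (u t ^ 2 - v t ^ 2) + 2 * r t * (u t * v t))
        - 2 * |K| * (u t ^ 2 + v t ^ 2))) t := fun t => by
    refine ((((hasDerivAt_id t).const_mul (-(2 * |K|))).exp).mul
      (((h t).1.pow 2).add ((h t).2.pow 2))).congr_deriv ?_
    simp
    ring
  have hanti : AntitoneOn (fun t => Real.exp (-(2 * |K|) * t) * (u t ^ 2 + v t ^ 2))
      (Set.Icc 0 L) := by
    refine antitoneOn_of_deriv_nonpos (convex_Icc 0 L)
      (fun t _ => (hd t).continuousAt.continuousWithinAt)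
      (fun t _ => (hd t).differentiableAt.differentiableWithinAt) fun t ht => ?_
    rw [(hd t).deriv]
    refine mul_nonpos_of_nonneg_of_nonpos (Real.exp_pos _).le ?_
    have hKt : |p t| + |r t| ≤ |K| := by
      have := hK t (interior_subset ht)
      rw [Real.norm_eq_abs] at this
      exact (le_abs_self _).trans (this.trans (le_abs_self _))
    have h1 : p t * (u t ^ 2 - v t ^ 2) ≤ |p t| * (u t ^ 2 + v t ^ 2) := by
      nlinarith [le_abs_self (p t), neg_abs_le (p t), sq_nonneg (u t), sq_nonneg (v t)]
    have h2 : 2 * r t * (u t * v t) ≤ |r t| * (u t ^ 2 + v t ^ 2) := by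
      nlinarith [mul_nonneg (sub_nonneg.2 (le_abs_self (r t))) (sq_nonneg (u t + v t)),
        mul_nonneg (neg_le_iff_add_nonneg.1 (neg_abs_le (r t))) (sq_nonneg (u t - v t))]
    nlinarith [mul_le_mul_of_nonneg_right hKt (add_nonneg (sq_nonneg (u t)) (sq_nonneg (v t)))]
  have h0 := hanti (Set.left_mem_Icc.2 (hx.1.trans hx.2)) hx hx.1
  simp only [mul_zero, Real.exp_zero, one_mul] at h0
  calc u x ^ 2 + v x ^ 2
      = Real.exp (2 * |K| * x) * (Real.exp (-(2 * |K|) * x) * (u x ^ 2 + v x ^ 2)) := by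
        rw [← mul_assoc, ← Real.exp_add]; simp
    _ ≤ Real.exp (2 * |K| * x) * (u 0 ^ 2 + v 0 ^ 2) := by gcongr
    _ ≤ Real.exp (2 * |K| * L) * (u 0 ^ 2 + v 0 ^ 2) := by
        have := hx.2
        gcongr

section Family

variable {u v : ℝ → ℝ → ℝ} {u₀ v₀ : ℝ}

lemma exists_abs_le (hp : Continuous p) (hr : Continuous r) (L : ℝ)
    (h : ∀ z, IsDiracSolution p r z (u z) (v z)) (hu : ∀ z, u z 0 = u₀) (hv : ∀ z, v z 0 = v₀) :
    ∃ C : ℝ, ∀ z, ∀ x ∈ Set.Icc 0 L, |u z x| ≤ C ∧ |v z x| ≤ C := by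
  obtain ⟨C, hC⟩ := exists_bound hp hr L
  refine ⟨√(C * (u₀ ^ 2 + v₀ ^ 2)), fun z x hx => ?_⟩
  have := hC z _ _ (h z) x hx
  rw [hu, hv] at this
  exact ⟨Real.abs_le_sqrt (by nlinarith [sq_nonneg (v z x)]),
    Real.abs_le_sqrt (by nlinarith [sq_nonneg (u z x)])⟩

lemma exists_wronskian_integrand_bound (hp : Continuous p) (hr : Continuous r) (L : ℝ)
    (h : ∀ z, IsDiracSolution p r z (u z) (v z)) (hu : ∀ z, u z 0 = u₀) (hv : ∀ z, v z 0 = v₀)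
    {w : ℝ} {b d : ℝ → ℝ} (k : IsDiracSolution p r w b d) :
    ∃ C : ℝ, ∀ z, ∀ x ∈ Set.Icc 0 L, ‖b x * u z x + d x * v z x‖ ≤ C := by
  obtain ⟨C, hC⟩ := exists_abs_le hp hr L h hu hv
  obtain ⟨B, hB⟩ := (isCompact_Icc (a := (0 : ℝ)) (b := L)).exists_bound_of_continuousOn
    k.continuous_fst.continuousOn
  obtain ⟨D, hD⟩ := (isCompact_Icc (a := (0 : ℝ)) (b := L)).exists_bound_of_continuousOn
    k.continuous_snd.continuousOn
  refine ⟨B * C + D * C, fun z x hx => (norm_add_le _ _).trans ?_⟩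
  rw [norm_mul, norm_mul]
  have h1 := hB x hx
  have h2 := hD x hx
  have := hC z x hx
  have hB0 := (norm_nonneg _).trans h1
  have hD0 := (norm_nonneg _).trans h2
  exact add_le_add (mul_le_mul h1 this.1 (norm_nonneg _) hB0)
    (mul_le_mul h2 this.2 (norm_nonneg _) hD0)

lemma continuousAt_wronskian (hp : Continuous p) (hr : Continuous r)
    (h : ∀ z, IsDiracSolution p r z (u z) (v z)) (hu : ∀ z, u z 0 = u₀) (hv : ∀ z, v z 0 = v₀)
    {w : ℝ} {b d : ℝ → ℝ} (k : IsDiracSolution p r w b d) {x : ℝ} (hx : 0 ≤ x) :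
    ContinuousAt (fun z => d x * u z x - b x * v z x) w := by
  obtain ⟨C, hC⟩ := exists_wronskian_integrand_bound hp hr x h hu hv k
  have hI : ∀ z, ‖∫ t in (0 : ℝ)..x, (b t * u z t + d t * v z t)‖ ≤ C * |x - 0| := fun z =>
    intervalIntegral.norm_integral_le_of_norm_le_const fun t ht => by
      rw [Set.uIoc_of_le hx] at ht
      exact hC z t (Set.Ioc_subset_Icc_self ht)
  have hz : Filter.Tendsto (fun z : ℝ => z - w) (nhds w) (nhds 0) :=
     (continuous_id.sub continuous_const).tendsto' w 0 (sub_self w)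
  have hlim := hz.zero_mul_isBoundedUnder_le
    (g := fun z => ∫ t in (0 : ℝ)..x, (b t * u z t + d t * v z t))
    (Filter.isBoundedUnder_of ⟨C * |x - 0|, hI⟩)
  rw [ContinuousAt]
  have he : ∀ z, d x * u z x - b x * v z x = (d 0 * u₀ - b 0 * v₀) +
      (z - w) * ∫ t in (0 : ℝ)..x, (b t * u z t + d t * v z t) := fun z => by
    rw [(h z).wronskian_eq k x, hu, hv]
  simp only [he, sub_self, zero_mul]
  exact hlim.const_add _

/-- Fundamental system of the Dirac system, normalised to the identity at `0`. -/
structure IsFundamental (p r : ℝ → ℝ) (w : ℝ) (a b c d : ℝ → ℝ) : Prop where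
  left : IsDiracSolution p r w a c
  right : IsDiracSolution p r w b d
  det : ∀ x, a x * d x - b x * c x = 1

lemma continuousAt_param (hp : Continuous p) (hr : Continuous r)
    (h : ∀ z, IsDiracSolution p r z (u z) (v z)) (hu : ∀ z, u z 0 = u₀) (hv : ∀ z, v z 0 = v₀)
    {w : ℝ} {a b c d : ℝ → ℝ} (k : IsFundamental p r w a b c d) {x : ℝ} (hx : 0 ≤ x) :
    ContinuousAt (fun z => u z x) w ∧ ContinuousAt (fun z => v z x) w := by
  have h1 := continuousAt_wronskian hp hr h hu hv k.left hx
  have h2 := continuousAt_wronskian hp hr h hu hv k.right hx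
  constructor
  · refine ((h2.const_mul (a x)).sub (h1.const_mul (b x))).congr (.of_forall fun z => ?_)
    simp only [Pi.sub_apply]
    linear_combination u z x * k.det x
  · refine ((h2.const_mul (c x)).sub (h1.const_mul (d x))).congr (.of_forall fun z => ?_)
    simp only [Pi.sub_apply]
    linear_combination v z x * k.det x

lemma hasDerivAt_const_add_sub_mul {g : ℝ → ℝ} {w : ℝ} (hg : ContinuousAt g w) (e : ℝ) :
    HasDerivAt (fun z => e + (z - w) * g z) (g w) w := by
  rw [hasDerivAt_iff_tendsto_slope]
  refine (hg.tendsto.mono_left nhdsWithin_le_nhds).congr' ?_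
  filter_upwards [self_mem_nhdsWithin] with z hz
  have : z - w ≠ 0 := sub_ne_zero.2 hz
  rw [slope_def_field]
  field_simp
  ring

lemma hasDerivAt_wronskian_param (hp : Continuous p) (hr : Continuous r)
    (h : ∀ z, IsDiracSolution p r z (u z) (v z)) (hu : ∀ z, u z 0 = u₀) (hv : ∀ z, v z 0 = v₀)
    {w : ℝ} (hcont : ∀ x, 0 ≤ x → ContinuousAt (fun z => u z x) w ∧ ContinuousAt (fun z => v z x) w)
    {b d : ℝ → ℝ} (k : IsDiracSolution p r w b d) {L : ℝ} (hL : 0 ≤ L) :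
    HasDerivAt (fun z => d L * u z L - b L * v z L)
      (∫ t in (0 : ℝ)..L, (b t * u w t + d t * v w t)) w := by
  obtain ⟨C, hC⟩ := exists_wronskian_integrand_bound hp hr L h hu hv k
  have hg : ContinuousAt (fun z => ∫ t in (0 : ℝ)..L, (b t * u z t + d t * v z t)) w := by
    refine intervalIntegral.continuousAt_of_dominated_interval (bound := fun _ => C)
      (.of_forall fun z => ?_) (.of_forall fun z => .of_forall fun t ht => ?_)
      intervalIntegrable_const (.of_forall fun t ht => ?_)
    · exact ((k.continuous_fst.mul (h z).continuous_fst).add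
        (k.continuous_snd.mul (h z).continuous_snd)).aestronglyMeasurable
    · rw [Set.uIoc_of_le hL] at ht
      exact hC z t (Set.Ioc_subset_Icc_self ht)
    · rw [Set.uIoc_of_le hL] at ht
      have := hcont t ht.1.le
      exact (this.1.const_mul _).add (this.2.const_mul _)
  convert hasDerivAt_const_add_sub_mul hg (d 0 * u₀ - b 0 * v₀) using 2 with z
  rw [(h z).wronskian_eq k L, hu, hv]

lemma hasDerivAt_param (hp : Continuous p) (hr : Continuous r)
    (h : ∀ z, IsDiracSolution p r z (u z) (v z)) (hu : ∀ z, u z 0 = u₀) (hv : ∀ z, v z 0 = v₀)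
    {w : ℝ} {a b c d : ℝ → ℝ} (k : IsFundamental p r w a b c d) {L : ℝ} (hL : 0 ≤ L) :
    HasDerivAt (fun z => u z L)
        (a L * (∫ t in (0 : ℝ)..L, (b t * u w t + d t * v w t)) -
          b L * ∫ t in (0 : ℝ)..L, (a t * u w t + c t * v w t)) w ∧
      HasDerivAt (fun z => v z L)
        (c L * (∫ t in (0 : ℝ)..L, (b t * u w t + d t * v w t)) -
          d L * ∫ t in (0 : ℝ)..L, (a t * u w t + c t * v w t)) w := by
  have hcont := fun x => continuousAt_param hp hr h hu hv k (x := x)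
  have h1 := hasDerivAt_wronskian_param hp hr h hu hv hcont k.left hL
  have h2 := hasDerivAt_wronskian_param hp hr h hu hv hcont k.right hL
  constructor
  · refine ((h2.const_mul (a L)).sub (h1.const_mul (b L))).congr_of_eventuallyEq
      (.of_forall fun z => ?_)
    simp only [Pi.sub_apply]
    linear_combination (-u z L) * k.det L
  · refine ((h2.const_mul (c L)).sub (h1.const_mul (d L))).congr_of_eventuallyEq
      (.of_forall fun z => ?_)
    simp only [Pi.sub_apply]
    linear_combination (-v z L) * k.det L

end Family

lemma IsFundamental.gram_pos {w : ℝ} {a b c d : ℝ → ℝ} (k : IsFundamental p r w a b c d) {L : ℝ}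
    (hL : 0 < L) {e f : ℝ} (hef : e ≠ 0 ∨ f ≠ 0) :
    0 < e ^ 2 * (∫ t in (0 : ℝ)..L, (a t * a t + c t * c t))
      - 2 * e * f * (∫ t in (0 : ℝ)..L, (a t * b t + c t * d t))
      + f ^ 2 * ∫ t in (0 : ℝ)..L, (b t * b t + d t * d t) := by
  have ha := k.left.continuous_fst
  have hb := k.right.continuous_fst
  have hc := k.left.continuous_snd
  have hd := k.right.continuous_snd
  rw [← intervalIntegral.integral_const_mul, ← intervalIntegral.integral_const_mul,
    ← intervalIntegral.integral_const_mul, ← intervalIntegral.integral_sub,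
    ← intervalIntegral.integral_add]
  · refine intervalIntegral.intervalIntegral_pos_of_pos
      (Continuous.intervalIntegrable (by fun_prop) _ _) (fun t => ?_) hL
    have hdet := k.det t
    have hsum : 0 < (e * a t - f * b t) ^ 2 + (e * c t - f * d t) ^ 2 := by
      by_contra! hle
      have h1 : e * a t - f * b t = 0 := by
        nlinarith [sq_nonneg (e * a t - f * b t), sq_nonneg (e * c t - f * d t)]
      have h2 : e * c t - f * d t = 0 := by
        nlinarith [sq_nonneg (e * a t - f * b t), sq_nonneg (e * c t - f * d t)]
      have he : e = 0 := by linear_combination d t * h1 - b t * h2 - e * hdet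
      have hf : f = 0 := by linear_combination c t * h1 - a t * h2 - f * hdet
      exact hef.elim (· he) (· hf)
    linarith
  all_goals exact Continuous.intervalIntegrable (by fun_prop) _ _

end IsDiracSolution

lemma exists_sign_of_ne_zero {f : ℝ → ℝ} {α β : ℝ} (hf : ContinuousOn f (Set.Icc α β))
    (h0 : ∀ t ∈ Set.Icc α β, f t ≠ 0) :
    ∃ s : ℝ, (s = 1 ∨ s = -1) ∧ ∀ t ∈ Set.Icc α β, 0 < s * f t := by
  by_cases hpos : ∀ t ∈ Set.Icc α β, 0 < f t
  · exact ⟨1, .inl rfl, by simpa using hpos⟩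
  · push Not at hpos
    obtain ⟨x, hx, hfx⟩ := hpos
    refine ⟨-1, .inr rfl, fun t ht => ?_⟩
    by_contra! hft
    obtain ⟨y, hy, hfy⟩ := isPreconnected_Icc.intermediate_value hx ht hf
      (show (0 : ℝ) ∈ Set.Icc (f x) (f t) from ⟨hfx, by linarith⟩)
    exact h0 y hy hfy

lemma deriv_nonneg_of_left_min {f : ℝ → ℝ} {f' α β : ℝ} (hαβ : α < β) (hf : HasDerivAt f f' α)
    (hmin : ∀ t ∈ Set.Ioo α β, f α ≤ f t) : 0 ≤ f' := by
  have ht := (hasDerivAt_iff_tendsto_slope.1 hf).mono_left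
    (nhdsWithin_mono α (fun x (hx : α < x) => hx.ne') : nhdsWithin α (Set.Ioi α) ≤ _)
  refine ge_of_tendsto ht ?_
  filter_upwards [Ioo_mem_nhdsGT hαβ] with t ht
  rw [slope_def_field]
  exact div_nonneg (sub_nonneg.2 (hmin t ht)) (sub_nonneg.2 ht.1.le)

lemma deriv_nonpos_of_right_min {f : ℝ → ℝ} {f' α β : ℝ} (hαβ : α < β) (hf : HasDerivAt f f' β)
    (hmin : ∀ t ∈ Set.Ioo α β, f β ≤ f t) : f' ≤ 0 := by
  have ht := (hasDerivAt_iff_tendsto_slope.1 hf).mono_left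
    (nhdsWithin_mono β (fun x (hx : x < β) => hx.ne) : nhdsWithin β (Set.Iio β) ≤ _)
  refine le_of_tendsto ht ?_
  filter_upwards [Ioo_mem_nhdsLT hαβ] with t ht
  rw [slope_def_field]
  exact div_nonpos_of_nonneg_of_nonpos (sub_nonneg.2 (hmin t ht)) (sub_nonpos.2 ht.2.le)

/-- A function increasing through each of its zeros has no two zeros. -/
lemma not_lt_of_zeros {f f' : ℝ → ℝ} {x y : ℝ} (hf : ∀ t, HasDerivAt f (f' t) t)
    (hpos : ∀ t ∈ Set.Icc x y, f t = 0 → 0 < f' t) (hx : f x = 0) (hy : f y = 0) : ¬ x < y := by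
  intro hxy
  have hnn : ∀ t ∈ Set.Icc x y, -f t ≤ 0 := fun t ht =>
    image_le_of_deriv_right_lt_deriv_boundary' (f := fun t => -f t) (f' := fun t => -f' t)
      (B := fun _ => 0) (B' := fun _ => 0) (a := x) (b := y)
      (fun t _ => (hf t).neg.continuousAt.continuousWithinAt)
      (fun t _ => (hf t).neg.hasDerivWithinAt) (by simp [hx]) continuousOn_const
      (fun t _ => hasDerivWithinAt_const _ _ _)
      (fun t ht h => neg_neg_of_pos (hpos t (Set.Ico_subset_Icc_self ht) (neg_eq_zero.1 h))) ht
  have := deriv_nonpos_of_right_min hxy (hf y) fun t ht => by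
    have := hnn t (Set.Ioo_subset_Icc_self ht)
    linarith
  exact absurd (hpos y (Set.right_mem_Icc.2 hxy.le) hy) this.not_gt

lemma IsDiracSolution.existsUnique_zero_in_gap {p r : ℝ → ℝ} (hp : Continuous p)
    (hr : Continuous r) {L : ℝ} (hL : 0 < L) {a b c d : ℝ → ℝ → ℝ}
    (hac : ∀ z, IsDiracSolution p r z (a z) (c z)) (hbd : ∀ z, IsDiracSolution p r z (b z) (d z))
    (ha0 : ∀ z, a z 0 = 1) (hb0 : ∀ z, b z 0 = 0) (hc0 : ∀ z, c z 0 = 0) (hd0 : ∀ z, d z 0 = 1)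
    {α β : ℝ} (hαβ : α < β) (hα : (a α L + d α L) ^ 2 = 4) (hβ : (a β L + d β L) ^ 2 = 4)
    (hgap : ∀ t ∈ Set.Ioo α β, 4 < (a t L + d t L) ^ 2) :
    ∃! μ : ℝ, μ ∈ Set.Icc α β ∧ b μ L = 0 := by
  have hfund : ∀ z, IsFundamental p r z (a z) (b z) (c z) (d z) := fun z =>
    ⟨hac z, hbd z, fun x => by
      have := (hac z).wronskian_const (hbd z) x
      rw [ha0, hb0, hc0, hd0] at this
      linarith⟩
  have hA := fun z => hasDerivAt_param hp hr hac ha0 hc0 (hfund z) hL.le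
  have hB := fun z => hasDerivAt_param hp hr hbd hb0 hd0 (hfund z) hL.le
  have hT := fun z => (hA z).1.add (hB z).2
  have hcT : Continuous fun z => a z L + d z L :=
    continuous_iff_continuousAt.2 fun z => (hT z).continuousAt
  have hcB : Continuous fun z => b z L :=
    continuous_iff_continuousAt.2 fun z => (hB z).1.continuousAt
  have hsq : ∀ t ∈ Set.Icc α β, 4 ≤ (a t L + d t L) ^ 2 := fun t ht => by
    rcases eq_or_lt_of_le ht.1 with rfl | h1
    · exact hα.ge
    rcases eq_or_lt_of_le ht.2 with rfl | h2
    · exact hβ.ge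
    exact (hgap t ⟨h1, h2⟩).le
  obtain ⟨s, hs, hsT⟩ := exists_sign_of_ne_zero (f := fun z => a z L + d z L) hcT.continuousOn
    fun t ht h0 => by
      have := hsq t ht
      norm_num [h0] at this
  have hs2 : s ^ 2 = 1 := by rcases hs with rfl | rfl <;> norm_num
  have hdet := fun z => (hfund z).det L
  refine existsUnique_of_exists_of_unique ?_ ?_
  · by_contra! hno
    obtain ⟨σ, hσ, hσB⟩ := exists_sign_of_ne_zero (f := fun z => b z L) hcB.continuousOn
      fun t ht => hno t ht
    have hcomm : ∀ z, ∫ t in (0 : ℝ)..L, (b z t * a z t + d z t * c z t) =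
        ∫ t in (0 : ℝ)..L, (a z t * b z t + c z t * d z t) := fun z => by
      simp only [mul_comm]
    -- at an end of the gap the trace and `b` vary in opposite directions
    have hend : ∀ z ∈ Set.Icc α β, (a z L + d z L) ^ 2 = 4 →
        ∃ T', HasDerivAt (fun z => a z L + d z L) T' z ∧ σ * T' < 0 := fun z hz hz4 => by
      refine ⟨_, hT z, ?_⟩
      have hg := (hfund z).gram_pos hL (e := b z L) (f := (a z L - d z L) / 2)
        (.inl (hno z hz))
      have hσz := hσB z hz
      rw [hcomm]
      set P := ∫ t in (0 : ℝ)..L, (a z t * b z t + c z t * d z t)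
      set R := ∫ t in (0 : ℝ)..L, (b z t * b z t + d z t * d z t)
      set S := ∫ t in (0 : ℝ)..L, (a z t * a z t + c z t * c z t)
      have hf2 : ((a z L - d z L) / 2) ^ 2 = -(b z L * c z L) := by
        linear_combination hz4 / 4 - hdet z
      rw [hf2] at hg
      have hσ2 : σ ^ 2 = 1 := by rcases hσ with rfl | rfl <;> norm_num
      by_contra! hle
      nlinarith [mul_nonneg hle hσz.le]
    have hmin : ∀ e, (a e L + d e L) ^ 2 = 4 → e ∈ Set.Icc α β → ∀ t ∈ Set.Ioo α β,
        s * (a e L + d e L) ≤ s * (a t L + d t L) := fun e he hemem t ht => by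
      refine (sq_le_sq₀ (hsT e hemem).le (hsT t (Set.Ioo_subset_Icc_self ht)).le).1 ?_
      rw [mul_pow, mul_pow, hs2, he]
      linarith [hgap t ht]
    have hαm := Set.left_mem_Icc.2 hαβ.le
    have hβm := Set.right_mem_Icc.2 hαβ.le
    obtain ⟨Ta, hTa, hσa⟩ := hend α hαm hα
    obtain ⟨Tb, hTb, hσb⟩ := hend β hβm hβ
    have h1 := deriv_nonneg_of_left_min hαβ (hTa.const_mul s) (hmin α hα hαm)
    have h2 := deriv_nonpos_of_right_min hαβ (hTb.const_mul s) (hmin β hβ hβm)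
    rcases hs with rfl | rfl <;> rcases hσ with rfl | rfl <;> linarith
  · have hB' : ∀ t ∈ Set.Icc α β, s * b t L = 0 → 0 < s *
        (a t L * (∫ x in (0 : ℝ)..L, (b t x * b t x + d t x * d t x)) -
          b t L * ∫ x in (0 : ℝ)..L, (a t x * b t x + c t x * d t x)) := fun t ht h0 => by
      have hb : b t L = 0 := by linear_combination s * h0 - b t L * hs2
      have hR := (hfund t).gram_pos hL (e := 0) (f := 1) (.inr one_ne_zero)
      have had := hdet t
      have hst := hsT t ht
      simp only [hb, zero_mul, sub_zero] at had ⊢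
      norm_num at hR
      have hsa : 0 < s * a t L := by
        by_contra! hle
        nlinarith [mul_nonneg_of_nonpos_of_nonpos hle hle, sq_nonneg (a t L)]
      rw [← mul_assoc]
      exact mul_pos hsa hR
    have hle : ∀ x ∈ Set.Icc α β, ∀ y ∈ Set.Icc α β, b x L = 0 → b y L = 0 → ¬ x < y :=
      fun x hx y hy hbx hby => not_lt_of_zeros (f := fun z => s * b z L)
        (fun t => (hB t).1.const_mul s)
        (fun t ht => hB' t ⟨hx.1.trans ht.1, ht.2.trans hy.2⟩) (by simp [hbx]) (by simp [hby])
    rintro x y ⟨hx, hbx⟩ ⟨hy, hby⟩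
    exact le_antisymm (not_lt.1 (hle y hy x hx hby hbx)) (not_lt.1 (hle x hx y hy hbx hby))

lemma Umat_inv : Umat⁻¹ = !![1 / 2, Complex.I / 2; 1 / 2, -Complex.I / 2] := by
  refine Matrix.inv_eq_right_inv ?_
  ext i j
  fin_cases i <;> fin_cases j <;>
    simp [Umat, Matrix.mul_apply, Fin.sum_univ_two] <;> ring_nf; simp

lemma Ytil_eq (Y : ℂ → ℝ → Matrix (Fin 2) (Fin 2) ℂ) (z : ℂ) (x : ℝ) :
    Ytil Y z x =
      !![(Y z x 0 0 + Y z x 1 0 + Y z x 0 1 + Y z x 1 1) / 2,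
        Complex.I * (Y z x 0 0 + Y z x 1 0 - Y z x 0 1 - Y z x 1 1) / 2;
        Complex.I * (-Y z x 0 0 + Y z x 1 0 - Y z x 0 1 + Y z x 1 1) / 2,
        (Y z x 0 0 - Y z x 1 0 - Y z x 0 1 + Y z x 1 1) / 2] := by
  rw [Ytil, Umat_inv, Umat]
  ext i j
  fin_cases i <;> fin_cases j <;>
    simp [Matrix.mul_apply, Fin.sum_univ_two, Matrix.vecMul, dotProduct] <;> ring_nf
  rw [Complex.I_sq]
  ring

lemma Ytil_trace (Y : ℂ → ℝ → Matrix (Fin 2) (Fin 2) ℂ) (z : ℂ) (x : ℝ) :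
    (Y z x).trace = Ytil Y z x 0 0 + Ytil Y z x 1 1 := by
  simp [Ytil_eq, Matrix.trace_fin_two]
  ring

lemma Ytil_hasDerivAt {q : ℝ → ℂ} {Y : ℂ → ℝ → Matrix (Fin 2) (Fin 2) ℂ}
    (hODE : ∀ (z : ℂ) (x : ℝ) (i j : Fin 2),
      HasDerivAt (fun t => Y z t i j)
        ((((-(Complex.I * z)) • sigma3 + Qmat q x) * Y z x) i j) x) (z : ℂ) (x : ℝ) (j : Fin 2) :
    HasDerivAt (fun t => Ytil Y z t 0 j)
        ((q x).re * Ytil Y z x 0 j + (z + (q x).im) * Ytil Y z x 1 j) x ∧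
      HasDerivAt (fun t => Ytil Y z t 1 j)
        (((q x).im - z) * Ytil Y z x 0 j - (q x).re * Ytil Y z x 1 j) x := by
  have hq := (Complex.re_add_im (q x)).symm
  have hq' : (starRingEnd ℂ) (q x) = (q x).re - (q x).im * Complex.I := by
    apply Complex.ext <;> simp
  generalize (q x).re = ρ at hq hq' ⊢
  generalize (q x).im = τ at hq hq' ⊢
  rw [hq] at hq'
  have h00 := hODE z x 0 0
  have h01 := hODE z x 0 1
  have h10 := hODE z x 1 0
  have h11 := hODE z x 1 1
  simp only [sigma3, Qmat, hq, hq', Matrix.mul_apply, Fin.sum_univ_two, Matrix.add_apply,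
    Matrix.smul_apply, Matrix.of_apply, Matrix.cons_val', Matrix.cons_val_zero,
    Matrix.cons_val_one, Matrix.cons_val_fin_one, smul_eq_mul] at h00 h01 h10 h11
  have hu0 := (((h00.add h10).add h01).add h11).div_const 2
  have hu1 := ((((h00.add h10).sub h01).sub h11).const_mul Complex.I).div_const 2
  have hv0 := ((((h00.neg.add h10).sub h01).add h11).const_mul Complex.I).div_const 2
  have hv1 := (((h00.sub h10).sub h01).add h11).div_const 2
  simp only [Ytil_eq]
  fin_cases j
  · refine ⟨hu0.congr_deriv ?_, hv0.congr_deriv ?_⟩ <;>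
      simp only [Fin.zero_eta, Matrix.of_apply, Matrix.cons_val', Matrix.cons_val_zero,
        Matrix.cons_val_one, Matrix.cons_val_fin_one]
    · ring
    · ring_nf
      rw [Complex.I_sq]
      ring
  · refine ⟨hu1.congr_deriv ?_, hv1.congr_deriv ?_⟩ <;>
      simp only [Fin.mk_one, Matrix.of_apply, Matrix.cons_val', Matrix.cons_val_zero,
        Matrix.cons_val_one, Matrix.cons_val_fin_one]
    · ring_nf
      rw [Complex.I_sq]
      ring
    · ring

lemma Ytil_re_im_isDiracSolution {q : ℝ → ℂ} {Y : ℂ → ℝ → Matrix (Fin 2) (Fin 2) ℂ}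
    (hODE : ∀ (z : ℂ) (x : ℝ) (i j : Fin 2),
      HasDerivAt (fun t => Y z t i j)
        ((((-(Complex.I * z)) • sigma3 + Qmat q x) * Y z x) i j) x) (z : ℝ) (j : Fin 2) :
    IsDiracSolution (fun x => (q x).re) (fun x => (q x).im) z
        (fun x => (Ytil Y z x 0 j).re) (fun x => (Ytil Y z x 1 j).re) ∧
      IsDiracSolution (fun x => (q x).re) (fun x => (q x).im) z
        (fun x => (Ytil Y z x 0 j).im) (fun x => (Ytil Y z x 1 j).im) := by
  refine ⟨fun x => ?_, fun x => ?_⟩ <;> obtain ⟨hu, hv⟩ := Ytil_hasDerivAt hODE z x j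
  · refine ⟨(Complex.reCLM.hasFDerivAt.comp_hasDerivAt x hu).congr_deriv ?_,
      (Complex.reCLM.hasFDerivAt.comp_hasDerivAt x hv).congr_deriv ?_⟩ <;> simp
  · refine ⟨(Complex.imCLM.hasFDerivAt.comp_hasDerivAt x hu).congr_deriv ?_,
      (Complex.imCLM.hasFDerivAt.comp_hasDerivAt x hv).congr_deriv ?_⟩ <;> simp

lemma Ytil_zero {Y : ℂ → ℝ → Matrix (Fin 2) (Fin 2) ℂ} (hY0 : ∀ z, Y z 0 = 1) (z : ℂ) :
    Ytil Y z 0 = 1 := by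
  rw [Ytil_eq, hY0]
  ext i j
  fin_cases i <;> fin_cases j <;> simp

/-- For real `z` the matrix `Ỹ(x,z)` is real. -/
lemma Ytil_im_eq_zero {q : ℝ → ℂ} {Y : ℂ → ℝ → Matrix (Fin 2) (Fin 2) ℂ} (hY0 : ∀ z, Y z 0 = 1)
    (hODE : ∀ (z : ℂ) (x : ℝ) (i j : Fin 2),
      HasDerivAt (fun t => Y z t i j)
        ((((-(Complex.I * z)) • sigma3 + Qmat q x) * Y z x) i j) x)
    (z x : ℝ) (i j : Fin 2) : (Ytil Y z x i j).im = 0 := by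
  have h := Ytil_re_im_isDiracSolution hODE z
  have hdet := (h 0).1.wronskian_const (h 1).1 x
  have h0 := (h j).2.wronskian_const (h 0).1 x
  have h1 := (h j).2.wronskian_const (h 1).1 x
  have hinit : ∀ i, (Ytil Y z 0 i j).im = 0 := fun i => by
    rw [Ytil_zero hY0, Matrix.one_apply]
    split_ifs <;> simp
  simp only [hinit, mul_zero, sub_zero] at h0 h1
  simp only [Ytil_zero hY0, Matrix.one_apply_eq, ne_eq, one_ne_zero, zero_ne_one,
    not_false_eq_true, Matrix.one_apply_ne, Complex.one_re, Complex.zero_re, mul_one, mul_zero,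
    sub_zero] at hdet
  fin_cases i
  · simp only [Fin.zero_eta]
    linear_combination (Ytil Y z x 0 0).re * h1 - (Ytil Y z x 0 1).re * h0 -
      (Ytil Y z x 0 j).im * hdet
  · simp only [Fin.mk_one]
    linear_combination (Ytil Y z x 1 0).re * h1 - (Ytil Y z x 1 1).re * h0 -
      (Ytil Y z x 1 j).im * hdet


/-- in (the closure of) every nondegenerate spectral gap `[a,b]`
(i.e. `Δ(a)² = Δ(b)² = 1` and `Δ² > 1` on `(a,b)`), the function `z ↦ ỹ₁₂(L,z)` has
exactly one zero. -/
theorem unique_dirichlet_eigenvalue_in_gap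
    (L : ℝ) (hL : 0 < L)
    (q : ℝ → ℂ) (hq : Continuous q) (hper : ∀ x, q (x + L) = q x)
    (Y : ℂ → ℝ → Matrix (Fin 2) (Fin 2) ℂ)
    (hY0 : ∀ z, Y z 0 = 1)
    (hODE : ∀ (z : ℂ) (x : ℝ) (i j : Fin 2),
      HasDerivAt (fun t => Y z t i j)
        ((((-(Complex.I * z)) • sigma3 + Qmat q x) * Y z x) i j) x)
    (a b : ℝ) (hab : a < b)
    (ha : ((Y (a : ℂ) L).trace / 2) ^ 2 = 1)
    (hb : ((Y (b : ℂ) L).trace / 2) ^ 2 = 1)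
    (hgap : ∀ t : ℝ, t ∈ Set.Ioo a b → 1 < (((Y (t : ℂ) L).trace / 2).re) ^ 2) :
    ∃! μ : ℝ, μ ∈ Set.Icc a b ∧ Ytil Y (μ : ℂ) L 0 1 = 0 := by
  have hre : ∀ (t : ℝ) (i j : Fin 2), Ytil Y t L i j = ((Ytil Y t L i j).re : ℂ) :=
    fun t i j => Complex.ext rfl (by simpa using Ytil_im_eq_zero hY0 hODE t L i j)
  have htr : ∀ t : ℝ, (Y t L).trace = (((Ytil Y t L 0 0).re + (Ytil Y t L 1 1).re : ℝ) : ℂ) :=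
    fun t => by rw [Ytil_trace, hre t 0 0, hre t 1 1]; simp
  have hend : ∀ t : ℝ, ((Y t L).trace / 2) ^ 2 = 1 →
      ((Ytil Y t L 0 0).re + (Ytil Y t L 1 1).re) ^ 2 = 4 := fun t ht => by
    rw [htr] at ht
    have : (((Ytil Y t L 0 0).re + (Ytil Y t L 1 1).re) / 2) ^ 2 = 1 := by exact_mod_cast ht
    linarith
  have hsol := Ytil_re_im_isDiracSolution hODE
  have hmain := IsDiracSolution.existsUnique_zero_in_gap
    (Complex.continuous_re.comp hq) (Complex.continuous_im.comp hq) hL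
    (fun z => (hsol z 0).1) (fun z => (hsol z 1).1)
    (fun z => by simp [Ytil_zero hY0]) (fun z => by simp [Ytil_zero hY0])
    (fun z => by simp [Ytil_zero hY0]) (fun z => by simp [Ytil_zero hY0])
    hab (hend a ha) (hend b hb) fun t ht => by
      have h := hgap t ht
      rw [htr, ← Complex.ofReal_ofNat 2, ← Complex.ofReal_div, Complex.ofReal_re] at h
      linarith
  refine (existsUnique_congr fun μ => and_congr_right fun _ => ?_).1 hmain
  rw [hre μ 0 1, Complex.ofReal_eq_zero, Complex.ofReal_re]
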